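/- Let g be a root-reductive Lie algebra with Dynkin Borel subalgebra b. The category O = O(g,b) is a Grothendieck category: it is abelian, admits set-indexed direct sums, direct limits of short exact sequences are exact, and it has a generator. In particular, O has enough injective objects. -/

import Mathlib

set_option linter.unusedSectionVars false

open UniversalEnvelopingAlgebra

noncomputable section

universe u

variable (K : Type) [Field K] [IsAlgClosed K] [CharZero K]
variable (g : Type) [LieRing g] [LieAlgebra K g]

/-- The weight space of a Lie module for a weight `χ` of a subalgebra `h`. -/
def wtSpace (h : LieSubalgebra K g) (M : Type) [AddCommGroup M] [Module K M]
    [LieRingModule g M] [LieModule K g M] (χ : Module.Dual K h) : Submodule K M where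
  carrier := {m | ∀ H : h, ⁅(H : g), m⁆ = χ H • m}
  add_mem' := by intro a b ha hb H; rw [lie_add, ha H, hb H, smul_add]
  zero_mem' := by intro H; rw [lie_zero, smul_zero]
  smul_mem' := by intro c m hm H; rw [lie_smul, hm H, smul_comm]

/-- The root space of `g` relative to `h` for the functional `α`. -/
abbrev rootSp (h : LieSubalgebra K g) (α : Module.Dual K h) : Submodule K g :=
  wtSpace K g h g α

/-- Notation for the universal enveloping algebra. -/
abbrev UEA (L : Type) [LieRing L] [LieAlgebra K L] : Type :=
  UniversalEnvelopingAlgebra K L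

variable {K} in
/-- The Lie module structure on a quotient of the universal enveloping algebra
by a left ideal. -/
instance uqLRM (L : Type) [LieRing L] [LieAlgebra K L]
    (I : Submodule (UEA K L) (UEA K L)) : LieRingModule L ((UEA K L) ⧸ I) where
  bracket x m := ι K x • m
  add_lie x y m := by
    show (ι K (x + y)) • m = (ι K x) • m + (ι K y) • m
    rw [map_add, add_smul]
  lie_add x m n := by
    show (ι K x) • (m + n) = (ι K x) • m + (ι K x) • n
    rw [smul_add]
  leibniz_lie x y m := by
    show (ι K x) • ((ι K y) • m) = (ι K ⁅x, y⁆) • m + (ι K y) • ((ι K x) • m)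
    letI : LieRing (UniversalEnvelopingAlgebra K L) := LieRing.ofAssociativeRing
    rw [LieHom.map_lie, LieRing.of_associative_ring_bracket, sub_smul, mul_smul, mul_smul,
      sub_add_cancel]

variable {K} in
instance uqLM (L : Type) [LieRing L] [LieAlgebra K L]
    (I : Submodule (UEA K L) (UEA K L)) : LieModule K L ((UEA K L) ⧸ I) where
  smul_lie c x m := by
    show (ι K (c • x)) • m = c • ((ι K x) • m)
    rw [map_smul]
    exact smul_assoc c (ι K x) m
  lie_smul c x m := by
    show (ι K x) • (c • m) = c • ((ι K x) • m)
    exact smul_comm _ _ _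

/-- A root-reductive Lie algebra together with a splitting Borel subalgebra `b ⊇ h`
containing a fixed splitting maximal toral (Cartan) subalgebra `h`.  The fields record:
an exhausting chain `gc n` of nested finite-dimensional reductive subalgebras, each
reductive in the next, with compatible Cartan subalgebras and root vectors; the root
decomposition of `g` with respect to `h` with one-dimensional root spaces; a positive
system `Φp` closed under addition and the corresponding Borel subalgebra `b = h ⊕ n⁺`;
the anti-involution `τ`; coroots and the weight `ρ`. -/
structure RootReductive where
  h : LieSubalgebra K g
  gc : ℕ → LieSubalgebra K g
  gc_mono : Monotone gc
  gc_findim : ∀ n, FiniteDimensional K (gc n)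
  gc_exhausts : ∀ x : g, ∃ n, x ∈ gc n
  gc_reductive : ∀ n, LieAlgebra.radical K (gc n) = LieAlgebra.center K (gc n)
  gc_red_in : ∀ n, ∀ N : Submodule K g, N ≤ (gc (n+1)).toSubmodule →
      (∀ x ∈ gc n, ∀ v ∈ N, ⁅x, v⁆ ∈ N) →
      ∃ N' : Submodule K g, N' ≤ (gc (n+1)).toSubmodule ∧
        (∀ x ∈ gc n, ∀ v ∈ N', ⁅x, v⁆ ∈ N') ∧
        N ⊓ N' = ⊥ ∧ N ⊔ N' = (gc (n+1)).toSubmodule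
  gc_cartan : ∀ n, ∃ hc : LieSubalgebra K (gc n),
      ((hc : Set (gc n)) = ((↑) : (gc n) → g) ⁻¹' (h : Set g)) ∧ hc.IsCartanSubalgebra
  h_exhaust : ∀ x ∈ h, ∃ n, x ∈ gc n
  Φ : Set (Module.Dual K h)
  root_iff : ∀ α, α ∈ Φ ↔ α ≠ 0 ∧ rootSp K g h α ≠ ⊥
  root_dim : ∀ α ∈ Φ, Module.rank K (rootSp K g h α) = 1
  gc_rootdec : ∀ n, (gc n).toSubmodule =
      ((gc n).toSubmodule ⊓ h.toSubmodule) ⊔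
        (⨆ α ∈ Φ, ((gc n).toSubmodule ⊓ rootSp K g h α))
  rootdec : h.toSubmodule ⊔ (⨆ α ∈ Φ, rootSp K g h α) = ⊤
  Φp : Set (Module.Dual K h)
  pos_subset : Φp ⊆ Φ
  pos_union : Φ = Φp ∪ (-Φp)
  pos_disjoint : Disjoint Φp (-Φp)
  pos_add : ∀ α ∈ Φp, ∀ β ∈ Φp, α + β ∈ Φ → α + β ∈ Φp
  b : LieSubalgebra K g
  h_le_b : h ≤ b
  b_def : b.toSubmodule = h.toSubmodule ⊔ (⨆ α ∈ Φp, rootSp K g h α)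
  np : LieSubalgebra K g
  np_def : np.toSubmodule = ⨆ α ∈ Φp, rootSp K g h α
  nm : LieSubalgebra K g
  nm_def : nm.toSubmodule = ⨆ α ∈ Φp, rootSp K g h (-α)
  τ : g →ₗ[K] g
  τ_invol : ∀ x, τ (τ x) = x
  τ_anti : ∀ x y, τ ⁅x, y⁆ = ⁅τ y, τ x⁆
  τ_h : ∀ x ∈ h, τ x = x
  τ_root : ∀ (α : Module.Dual K h), ∀ x ∈ rootSp K g h α, τ x ∈ rootSp K g h (-α)
  coroot : Module.Dual K h → h
  coroot_two : ∀ α ∈ Φ, α (coroot α) = 2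
  coroot_neg : ∀ α ∈ Φ, coroot (-α) = - coroot α
  ρ : Module.Dual K h
  ρ_simple : ∀ α ∈ Φp, (¬ ∃ β ∈ Φp, ∃ γ ∈ Φp, β + γ = α) → ρ (coroot α) = 1

namespace RootReductive

variable {K g} (S : RootReductive K g)

/-- The nilradical `n⁺` of the Borel subalgebra, as a submodule. -/
def nplus : Submodule K g := ⨆ α ∈ S.Φp, rootSp K g S.h α

/-- `Γ⁺`: the additive monoid of sums of positive roots. -/
def Γp : AddSubmonoid (Module.Dual K S.h) := AddSubmonoid.closure S.Φp

/-- The order `μ ≤ λ` iff `λ - μ ∈ Γ⁺`. -/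
def wle (μ lam : Module.Dual K S.h) : Prop := lam - μ ∈ S.Γp

/-- The set of simple (positive) roots. -/
def simples : Set (Module.Dual K S.h) :=
  {α ∈ S.Φp | ¬ ∃ β ∈ S.Φp, ∃ γ ∈ S.Φp, β + γ = α}

/-- `b` is a Dynkin Borel subalgebra: every element of `Γ⁺` is a sum of simple roots. -/
def IsDynkin : Prop := ∀ α ∈ S.Φp, α ∈ AddSubmonoid.closure S.simples

/-- The finite-rank subalgebra `g_n = g̃_n + h`. -/
def gfull (n : ℕ) : LieSubalgebra K g := S.gc n ⊔ S.h

/-- The roots `Φ_n` of `g_n`. -/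
def levelRoots (n : ℕ) : Set (Module.Dual K S.h) :=
  {α ∈ S.Φ | rootSp K g S.h α ≤ (S.gfull n).toSubmodule}

/-- The root lattice `ℤΦ_n`. -/
def zrootsLevel (n : ℕ) : AddSubgroup (Module.Dual K S.h) :=
  AddSubgroup.closure (S.levelRoots n)

/-- The root lattice `ℤΦ`. -/
def zroots : AddSubgroup (Module.Dual K S.h) := AddSubgroup.closure S.Φ

/-- The partial order `≤_n` relative to the positive roots of `g_n`. -/
def wleLevel (n : ℕ) (μ lam : Module.Dual K S.h) : Prop :=
  lam - μ ∈ AddSubmonoid.closure (S.Φp ∩ S.levelRoots n)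

/-- The defining left ideal of the Verma module `Δ(λ) = U(g)/I_λ`, where
`I_λ` is generated by `n⁺` and the elements `H - λ(H)`, `H ∈ h`. -/
def vIdeal (lam : Module.Dual K S.h) : Submodule (UEA K g) (UEA K g) :=
  Submodule.span (UEA K g)
    ({u | ∃ x ∈ S.nplus, u = ι K x} ∪
     {u | ∃ H : S.h, u = ι K (H : g) - algebraMap K (UEA K g) (lam H)})

/-- The Verma module `Δ(λ)`. -/
abbrev Verma (lam : Module.Dual K S.h) : Type := (UEA K g) ⧸ S.vIdeal lam

/-- The left ideal corresponding to the maximal submodule of `Δ(λ)`. -/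
def radIdeal (lam : Module.Dual K S.h) : Submodule (UEA K g) (UEA K g) :=
  sSup {J | S.vIdeal lam ≤ J ∧ J ≠ ⊤}

/-- The simple highest weight module `L(λ)`, the unique simple quotient of `Δ(λ)`. -/
abbrev SimpleHW (lam : Module.Dual K S.h) : Type := (UEA K g) ⧸ S.radIdeal lam

/-- The defining left ideal of the Verma module of a subalgebra `h ≤ a`, relative to the
Borel subalgebra `a ∩ b`. -/
def vIdealSub (a : LieSubalgebra K g) (ha : S.h ≤ a) (lam : Module.Dual K S.h) :
    Submodule (UEA K a) (UEA K a) :=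
  Submodule.span (UEA K a)
    ({u | ∃ x : a, (x : g) ∈ S.nplus ∧ u = ι K x} ∪
     {u | ∃ H : S.h, u = ι K (⟨(H : g), ha H.2⟩ : a) - algebraMap K (UEA K a) (lam H)})

/-- The Verma module `Δ_a(λ)` of a subalgebra `h ≤ a ≤ g`. -/
abbrev VermaSub (a : LieSubalgebra K g) (ha : S.h ≤ a) (lam : Module.Dual K S.h) : Type :=
  (UEA K a) ⧸ S.vIdealSub a ha lam

def radIdealSub (a : LieSubalgebra K g) (ha : S.h ≤ a) (lam : Module.Dual K S.h) :
    Submodule (UEA K a) (UEA K a) :=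
  sSup {J | S.vIdealSub a ha lam ≤ J ∧ J ≠ ⊤}

/-- The simple highest weight module `L_a(λ)` of a subalgebra `h ≤ a ≤ g`. -/
abbrev SimpleHWSub (a : LieSubalgebra K g) (ha : S.h ≤ a) (lam : Module.Dual K S.h) : Type :=
  (UEA K a) ⧸ S.radIdealSub a ha lam

end RootReductive

/-- The subquotient `B/(A ∩ B)` of a module attached to two submodules `A ≤ B`. -/
abbrev subquot {R M : Type} [Ring R] [AddCommGroup M] [Module R M]
    (A B : Submodule R M) : Type :=
  B ⧸ (A.comap B.subtype)

/-- The multiplicity `[M : N]` of a module `N` in a module `M`: the supremum, over all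
finite filtrations of `M`, of the number of subquotients isomorphic to `N`. -/
noncomputable def jhMult (R M N : Type) [Ring R] [AddCommGroup M] [Module R M]
    [AddCommGroup N] [Module R N] : Cardinal.{0} :=
  ⨆ (n : ℕ), ⨆ (F : Fin (n+1) →o Submodule R M),
    ⨆ (_ : F 0 = ⊥ ∧ F (Fin.last n) = ⊤),
      (Nat.card {i : Fin n //
        Nonempty ((subquot (F i.castSucc) (F i.succ)) ≃ₗ[R] N)} : Cardinal)

/-- The `K`-vector space structure on the space of `U(L)`-module homomorphisms,
via the central embedding `K → U(L)`. -/
def homKModule (L : Type) [LieRing L] [LieAlgebra K L] (M N : Type)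
    [AddCommGroup M] [Module (UEA K L) M] [AddCommGroup N] [Module (UEA K L) N] :
    Module K (M →ₗ[UEA K L] N) :=
  letI : Module K N := Module.compHom N (algebraMap K (UEA K L))
  letI : SMulCommClass (UEA K L) K N :=
    ⟨fun u c n => by
      show u • ((algebraMap K (UEA K L) c) • n) = (algebraMap K (UEA K L) c) • (u • n)
      rw [smul_smul, smul_smul, Algebra.commutes]⟩
  inferInstance

/-- The dimension over `K` of the space of `U(L)`-module homomorphisms. -/
noncomputable def homDim (L : Type) [LieRing L] [LieAlgebra K L] (M N : Type)
    [AddCommGroup M] [Module (UEA K L) M] [AddCommGroup N] [Module (UEA K L) N] :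
    Cardinal :=
  letI := homKModule K L M N
  Module.rank K (M →ₗ[UEA K L] N)

namespace RootReductive

variable {K g} (S : RootReductive K g)

/-- The weight set of weight `χ` of a `U(g)`-module. -/
def wtSet (M : Type) [AddCommGroup M] [Module (UEA K g) M]
    (χ : Module.Dual K S.h) : Set M :=
  {m | ∀ H : S.h, (ι K (H : g)) • m = (algebraMap K (UEA K g) (χ H)) • m}

/-- A `U(g)`-module is a weight module (i.e. semisimple as an `h`-module) if it is the
sum of its weight spaces. -/
def IsWeightMod (M : Type) [AddCommGroup M] [Module (UEA K g) M] : Prop :=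
  ∀ m : M, m ∈ AddSubgroup.closure (⋃ χ : Module.Dual K S.h, S.wtSet M χ)

/-- The support of a module: the set of weights whose weight space is non-zero. -/
def suppSet (M : Type) [AddCommGroup M] [Module (UEA K g) M] :
    Set (Module.Dual K S.h) :=
  {χ | ∃ m ∈ S.wtSet M χ, m ≠ 0}

/-- Local finiteness of the action of the Borel subalgebra `b`:
every vector lies in a finite-dimensional `b`-stable subspace. -/
def IsLocFin (M : Type) [AddCommGroup M] [Module (UEA K g) M] : Prop :=
  letI : Module K M := Module.compHom M (algebraMap K (UEA K g))
  ∀ m : M, ∃ N : Submodule K M, m ∈ N ∧ FiniteDimensional K N ∧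
    ∀ x ∈ S.b, ∀ v ∈ N, (ι K x) • v ∈ N

/-- The module has finite-dimensional weight spaces. -/
def HasFinDimWt (M : Type) [AddCommGroup M] [Module (UEA K g) M] : Prop :=
  letI : Module K M := Module.compHom M (algebraMap K (UEA K g))
  ∀ χ : Module.Dual K S.h, ∃ s : Finset M,
    ↑s ⊆ S.wtSet M χ ∧ S.wtSet M χ ⊆ (Submodule.span K (s : Set M) : Set M)

/-- Membership in category `O`: a weight module with locally finite `b`-action. -/
def InO (M : Type) [AddCommGroup M] [Module (UEA K g) M] : Prop :=
  S.IsWeightMod M ∧ S.IsLocFin M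

/-- A subset of `h^*` is an ideal for the order `≤`. -/
def IsIdeal (A : Set (Module.Dual K S.h)) : Prop :=
  ∀ lam ∈ A, ∀ μ, S.wle μ lam → μ ∈ A

/-- A subset of `h^*` is upper finite. -/
def UpperFinite (A : Set (Module.Dual K S.h)) : Prop :=
  ∀ μ ∈ A, {lam ∈ A | S.wle μ lam}.Finite

/-- The dot action of a linear automorphism of `h^*`: `w · λ = w(λ+ρ) - ρ`. -/
def dot (w : Module.Dual K S.h ≃ₗ[K] Module.Dual K S.h)
    (lam : Module.Dual K S.h) : Module.Dual K S.h :=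
  w (lam + S.ρ) - S.ρ

/-- The dot action of the reflection `r_α`: `r_α · λ = λ - (λ+ρ)(Hα) α`. -/
def rdot (α lam : Module.Dual K S.h) : Module.Dual K S.h :=
  lam - ((lam + S.ρ) (S.coroot α)) • α

/-- One step of the Bruhat order: `μ = r_α · λ ≤ λ` for a positive root `α`. -/
def bruhatStep (μ lam : Module.Dual K S.h) : Prop :=
  ∃ α ∈ S.Φp, μ = S.rdot α lam ∧ S.wle μ lam

/-- The Bruhat order on `h^*`. -/
def bruhat : Module.Dual K S.h → Module.Dual K S.h → Prop :=
  Relation.ReflTransGen (fun μ lam => S.bruhatStep μ lam)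

/-- The set of reflections `r_α`, `α ∈ Φ`, as linear automorphisms of `h^*`. -/
def reflSet : Set (Module.Dual K S.h ≃ₗ[K] Module.Dual K S.h) :=
  {w | ∃ α ∈ S.Φ, ∀ lam, w lam = lam - (lam (S.coroot α)) • α}

/-- The Weyl group `W`, generated by all reflections. -/
def weylGroup : Subgroup (Module.Dual K S.h ≃ₗ[K] Module.Dual K S.h) :=
  Subgroup.closure S.reflSet

/-- The integral Weyl group `W[λ]` of a weight. -/
def intWeyl (lam : Module.Dual K S.h) :
    Set (Module.Dual K S.h ≃ₗ[K] Module.Dual K S.h) :=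
  {w | w ∈ S.weylGroup ∧ S.dot w lam - lam ∈ S.zroots}

/-- The orbit `[[λ]] = W[λ] · λ`. -/
def orbit (lam : Module.Dual K S.h) : Set (Module.Dual K S.h) :=
  {μ | ∃ w ∈ S.intWeyl lam, μ = S.dot w lam}

/-- An integral weight. -/
def IsIntegral (lam : Module.Dual K S.h) : Prop :=
  ∀ w ∈ S.weylGroup, S.dot w lam - lam ∈ S.zroots

/-- A dominant weight. -/
def IsDominant (lam : Module.Dual K S.h) : Prop :=
  ∀ w ∈ S.intWeyl lam, S.wle (S.dot w lam) lam

/-- An antidominant weight. -/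
def IsAntidominant (lam : Module.Dual K S.h) : Prop :=
  ∀ w ∈ S.intWeyl lam, S.wle lam (S.dot w lam)

/-- A regular weight. -/
def IsRegular (lam : Module.Dual K S.h) : Prop :=
  ∀ w ∈ S.intWeyl lam, S.dot w lam = lam → w = 1

/-- A Verma flag with highest weights in a prescribed set. -/
def HasVermaFlagIn (A : Set (Module.Dual K S.h)) (M : Type) [AddCommGroup M]
    [Module (UEA K g) M] : Prop :=
  ∃ (n : ℕ) (F : Fin (n+1) →o Submodule (UEA K g) M), F 0 = ⊥ ∧ F (Fin.last n) = ⊤ ∧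
    ∀ i : Fin n, ∃ lam ∈ A,
      Nonempty ((subquot (F i.castSucc) (F i.succ)) ≃ₗ[UEA K g] S.Verma lam)

/-- A (finite) Verma flag. -/
def HasVermaFlag (M : Type) [AddCommGroup M] [Module (UEA K g) M] : Prop :=
  S.HasVermaFlagIn Set.univ M

end RootReductive
variable {K} {g}

open CategoryTheory Limits

/-- The category `O = O(g,b)`: the full subcategory of `U(g)`-modules which are weight
modules with locally finite `b`-action. -/
abbrev catO (S : RootReductive K g) : Type 1 :=
  CategoryTheory.ObjectProperty.FullSubcategory (fun M : ModuleCat (UEA K g) => S.InO M)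

namespace RootReductive

variable (S : RootReductive K g) {M N : Type} [AddCommGroup M] [Module (UEA K g) M]
  [AddCommGroup N] [Module (UEA K g) N]

lemma zero_mem_wtSet (χ : Module.Dual K S.h) : (0 : M) ∈ S.wtSet M χ := fun H => by
  simp only [smul_zero]

lemma add_mem_wtSet {χ : Module.Dual K S.h} {m n : M} (hm : m ∈ S.wtSet M χ)
    (hn : n ∈ S.wtSet M χ) : m + n ∈ S.wtSet M χ := fun H => by
  rw [smul_add, smul_add, hm H, hn H]

lemma neg_mem_wtSet {χ : Module.Dual K S.h} {m : M} (hm : m ∈ S.wtSet M χ) :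
    -m ∈ S.wtSet M χ := fun H => by
  rw [smul_neg, smul_neg, hm H]

lemma algebraMap_smul_mem_wtSet {χ : Module.Dual K S.h} {m : M} (hm : m ∈ S.wtSet M χ) (c : K) :
    algebraMap K (UEA K g) c • m ∈ S.wtSet M χ := fun H => by
  rw [smul_smul, ← Algebra.commutes, mul_smul, hm H, smul_smul, smul_smul, Algebra.commutes]

lemma map_mem_wtSet (f : M →ₗ[UEA K g] N) {χ : Module.Dual K S.h} {m : M}
    (hm : m ∈ S.wtSet M χ) : f m ∈ S.wtSet N χ := fun H => by
  rw [← map_smul, ← map_smul, hm H]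

lemma mem_wtSet_of_map_mem {f : M →ₗ[UEA K g] N} (hf : Function.Injective f)
    {χ : Module.Dual K S.h} {m : M} (hm : f m ∈ S.wtSet N χ) : m ∈ S.wtSet M χ := fun H =>
  hf <| by rw [map_smul, map_smul, hm H]

/-- A vector in the span of the weight spaces is a finite sum of weight vectors. -/
lemma exists_finsupp_of_mem_closure {m : M}
    (hm : m ∈ AddSubgroup.closure (⋃ χ : Module.Dual K S.h, S.wtSet M χ)) :
    ∃ v : Module.Dual K S.h →₀ M, (∀ χ, v χ ∈ S.wtSet M χ) ∧ ∑ χ ∈ v.support, v χ = m := by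
  classical
  change ∃ v : Module.Dual K S.h →₀ M, (∀ χ, v χ ∈ S.wtSet M χ) ∧ v.sum (fun _ x => x) = m
  induction hm using AddSubgroup.closure_induction with
  | mem x hx =>
    obtain ⟨χ, hχ⟩ := Set.mem_iUnion.1 hx
    refine ⟨Finsupp.single χ x, fun ψ => ?_, Finsupp.sum_single_index rfl⟩
    by_cases h : χ = ψ
    · subst h
      simpa using hχ
    · rw [Finsupp.single_eq_of_ne' h]
      exact S.zero_mem_wtSet ψ
  | zero => exact ⟨0, fun χ => S.zero_mem_wtSet χ, Finsupp.sum_zero_index⟩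
  | add x y _ _ hx hy =>
    obtain ⟨v, hv, rfl⟩ := hx
    obtain ⟨w, hw, rfl⟩ := hy
    exact ⟨v + w, fun χ => S.add_mem_wtSet (hv χ) (hw χ),
      Finsupp.sum_add_index' (fun _ => rfl) (fun _ _ _ => rfl)⟩
  | neg x _ hx =>
    obtain ⟨v, hv, rfl⟩ := hx
    refine ⟨-v, fun χ => S.neg_mem_wtSet (hv χ), ?_⟩
    rw [Finsupp.sum_neg_index (fun _ => rfl)]
    simp [Finsupp.sum]

/-- A submodule containing a sum of weight vectors of distinct weights contains each of them. -/
lemma mem_of_sum_mem (P : Submodule (UEA K g) M) (s : Finset (Module.Dual K S.h))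
    (v : Module.Dual K S.h → M) (hv : ∀ χ, v χ ∈ S.wtSet M χ) (hs : ∑ χ ∈ s, v χ ∈ P) :
    ∀ χ ∈ s, v χ ∈ P := by
  classical
  induction s using Finset.induction_on generalizing v with
  | empty => simp
  | insert a s ha ih =>
    have key : ∀ χ ∈ s, v χ ∈ P := by
      intro χ hχ
      have hne : χ ≠ a := fun h => ha (h ▸ hχ)
      obtain ⟨H, hH⟩ : ∃ H, χ H ≠ a H := by
        by_contra! h
        exact hne (LinearMap.ext h)
      have hsum : ∑ ψ ∈ s, algebraMap K (UEA K g) (ψ H - a H) • v ψ ∈ P := by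
        have h := P.sub_mem (P.smul_mem (ι K (H : g)) hs)
          (P.smul_mem (algebraMap K (UEA K g) (a H)) hs)
        rw [Finset.sum_insert ha, smul_add, smul_add, hv a H, add_sub_add_left_eq_sub,
          Finset.smul_sum, Finset.smul_sum, ← Finset.sum_sub_distrib] at h
        convert h using 2 with ψ
        rw [hv ψ H, map_sub, sub_smul]
      have h := P.smul_mem (algebraMap K (UEA K g) (χ H - a H)⁻¹)
        (ih _ (fun ψ => S.algebraMap_smul_mem_wtSet (hv ψ) (ψ H - a H)) hsum χ hχ)
      rwa [smul_smul, ← map_mul, inv_mul_cancel₀ (sub_ne_zero.2 hH), map_one, one_smul] at h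
    rw [Finset.sum_insert ha] at hs
    exact Finset.forall_mem_insert _ _ _ |>.2
      ⟨(P.add_mem_iff_left (P.sum_mem key)).1 hs, key⟩

lemma IsWeightMod.of_injective {S : RootReductive K g} (hN : S.IsWeightMod N)
    {f : M →ₗ[UEA K g] N} (hf : Function.Injective f) : S.IsWeightMod M := by
  intro m
  obtain ⟨v, hv, hm⟩ := S.exists_finsupp_of_mem_closure (hN (f m))
  have h := S.mem_of_sum_mem (LinearMap.range f) v.support v hv (hm ▸ LinearMap.mem_range_self f m)
  choose! w hw using h
  have hmw : ∑ χ ∈ v.support, w χ = m := hf <| by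
    rw [map_sum, Finset.sum_congr rfl hw, hm]
  rw [← hmw]
  refine sum_mem fun χ hχ => AddSubgroup.subset_closure (Set.mem_iUnion.2 ⟨χ, ?_⟩)
  exact S.mem_wtSet_of_map_mem hf (hw χ hχ ▸ hv χ)

/-- A vector lying in a finite-dimensional `b`-stable subspace. -/
def IsLocFinVec [Module K M] (m : M) : Prop :=
  ∃ V : Submodule K M, m ∈ V ∧ FiniteDimensional K V ∧ ∀ x ∈ S.b, ∀ v ∈ V, ι K x • v ∈ V

lemma isLocFinVec_zero [Module K M] : S.IsLocFinVec (0 : M) :=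
  ⟨⊥, Submodule.zero_mem _, inferInstance, fun x _ v hv => by
    rw [(Submodule.mem_bot K).1 hv, smul_zero]; exact Submodule.zero_mem _⟩

lemma IsLocFinVec.add {S : RootReductive K g} [Module K M] {m n : M} (hm : S.IsLocFinVec m)
    (hn : S.IsLocFinVec n) : S.IsLocFinVec (m + n) := by
  obtain ⟨V, hmV, hV, hbV⟩ := hm
  obtain ⟨W, hnW, hW, hbW⟩ := hn
  refine ⟨V ⊔ W, Submodule.add_mem_sup hmV hnW, inferInstance, fun x hx v hv => ?_⟩
  obtain ⟨y, hy, z, hz, rfl⟩ := Submodule.mem_sup.1 hv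
  rw [smul_add]
  exact Submodule.add_mem_sup (hbV x hx y hy) (hbW x hx z hz)

lemma IsLocFinVec.map {S : RootReductive K g} [Module K M] [IsScalarTower K (UEA K g) M]
    [Module K N] [IsScalarTower K (UEA K g) N] {m : M} (hm : S.IsLocFinVec m)
    (f : M →ₗ[UEA K g] N) : S.IsLocFinVec (f m) := by
  obtain ⟨V, hmV, hV, hbV⟩ := hm
  refine ⟨V.map (f.restrictScalars K), ⟨m, hmV, rfl⟩, inferInstance, ?_⟩
  rintro x hx _ ⟨v, hv, rfl⟩
  exact ⟨ι K x • v, hbV x hx v hv, f.map_smul _ _⟩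

lemma IsLocFinVec.of_injective {S : RootReductive K g} [Module K M]
    [IsScalarTower K (UEA K g) M] [Module K N] [IsScalarTower K (UEA K g) N]
    {f : M →ₗ[UEA K g] N} (hf : Function.Injective f) {m : M} (hm : S.IsLocFinVec (f m)) :
    S.IsLocFinVec m := by
  obtain ⟨V, hmV, hV, hbV⟩ := hm
  refine ⟨V.comap (f.restrictScalars K), hmV, ?_, fun x hx v hv => ?_⟩
  · exact Module.Finite.of_injective
      ((f.restrictScalars K).restrict (p := V.comap (f.restrictScalars K)) (q := V) fun _ h => h)
      fun a b hab => Subtype.ext (hf (congrArg Subtype.val hab))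
  · change f (ι K x • v) ∈ V
    rw [map_smul]
    exact hbV x hx _ hv

lemma isScalarTower_compHom (M : Type) [AddCommGroup M] [Module (UEA K g) M] :
    letI : Module K M := Module.compHom M (algebraMap K (UEA K g))
    IsScalarTower K (UEA K g) M :=
  letI : Module K M := Module.compHom M (algebraMap K (UEA K g))
  ⟨fun c u m => by rw [Algebra.smul_def, mul_smul]; rfl⟩

lemma IsLocFin.of_injective {S : RootReductive K g} (hN : S.IsLocFin N)
    {f : M →ₗ[UEA K g] N} (hf : Function.Injective f) : S.IsLocFin M := by
  let : Module K M := Module.compHom M (algebraMap K (UEA K g))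
  let : Module K N := Module.compHom N (algebraMap K (UEA K g))
  have := isScalarTower_compHom (K := K) (g := g) M
  have := isScalarTower_compHom (K := K) (g := g) N
  exact fun m => IsLocFinVec.of_injective hf (hN (f m))

lemma InO.of_injective {S : RootReductive K g} (hN : S.InO N)
    {f : M →ₗ[UEA K g] N} (hf : Function.Injective f) : S.InO M :=
  ⟨hN.1.of_injective hf, hN.2.of_injective hf⟩

/-- A module generated by images of modules in category `O` is in category `O`. -/
lemma inO_of_iSup_range_eq_top {J : Type*} {X : J → Type} [∀ j, AddCommGroup (X j)]
    [∀ j, Module (UEA K g) (X j)] (hX : ∀ j, S.InO (X j)) (f : ∀ j, X j →ₗ[UEA K g] M)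
    (hf : ⨆ j, LinearMap.range (f j) = ⊤) : S.InO M := by
  have hmem (m : M) : m ∈ ⨆ j, LinearMap.range (f j) := hf ▸ Submodule.mem_top
  refine ⟨fun m => ?_, fun m => ?_⟩
  · induction hmem m using Submodule.iSup_induction' with
    | mem j x hx =>
      obtain ⟨y, rfl⟩ := hx
      induction (hX j).1 y using AddSubgroup.closure_induction with
      | mem y hy =>
        obtain ⟨χ, hχ⟩ := Set.mem_iUnion.1 hy
        exact AddSubgroup.subset_closure (Set.mem_iUnion.2 ⟨χ, S.map_mem_wtSet (f j) hχ⟩)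
      | zero => rw [map_zero]; exact zero_mem _
      | add y z _ _ hy hz => rw [map_add]; exact add_mem hy hz
      | neg y _ hy => rw [map_neg]; exact neg_mem hy
    | zero => exact zero_mem _
    | add x y _ _ hx hy => exact add_mem hx hy
  · let : Module K M := Module.compHom M (algebraMap K (UEA K g))
    let (j : J) : Module K (X j) := Module.compHom (X j) (algebraMap K (UEA K g))
    have := isScalarTower_compHom (K := K) (g := g) M
    have (j : J) := isScalarTower_compHom (K := K) (g := g) (X j)
    change S.IsLocFinVec m
    induction hmem m using Submodule.iSup_induction' with
    | mem j x hx =>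
      obtain ⟨y, rfl⟩ := hx
      exact IsLocFinVec.map ((hX j).2 y) (f j)
    | zero => exact S.isLocFinVec_zero
    | add x y _ _ hx hy => exact hx.add hy

lemma inO_pi {J : Type} [Finite J] {X : J → Type} [∀ j, AddCommGroup (X j)]
    [∀ j, Module (UEA K g) (X j)] (hX : ∀ j, S.InO (X j)) : S.InO (∀ j, X j) := by
  classical
  exact S.inO_of_iSup_range_eq_top hX (LinearMap.single (UEA K g) X)
    (LinearMap.iSup_range_single _ _)

/-- Membership in category `O`, as a property of objects of the category of `U(g)`-modules. -/
abbrev inOProp : ObjectProperty (ModuleCat.{0} (UEA K g)) := fun M => S.InO M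

instance : S.inOProp.IsClosedUnderSubobjects where
  prop_of_mono f _ hY := InO.of_injective hY ((ModuleCat.mono_iff_injective f).1 inferInstance)

instance : S.inOProp.IsClosedUnderQuotients where
  prop_of_epi f _ hX := S.inO_of_iSup_range_eq_top (J := Unit) (fun _ => hX) (fun _ => f.hom) <| by
    rw [iSup_const]
    exact LinearMap.range_eq_top.2 ((ModuleCat.epi_iff_surjective f).1 inferInstance)

instance (J : Type*) [Category* J] : S.inOProp.IsClosedUnderColimitsOfShape J where
  colimitsOfShape_le := by
    rintro X ⟨p⟩
    let f (j : J) : p.diag.obj j →ₗ[UEA K g] X := (p.ι.app j).hom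
    refine S.inO_of_iSup_range_eq_top p.prop_diag_obj f ?_
    set R := ⨆ j, LinearMap.range (f j)
    have h : ModuleCat.ofHom R.mkQ = 0 := p.isColimit.hom_ext fun j => by
      ext x
      exact (Submodule.Quotient.mk_eq_zero R).2
        (Submodule.mem_iSup_of_mem j (LinearMap.mem_range_self (f j) x))
    rw [← R.ker_mkQ, ← ModuleCat.hom_ofHom R.mkQ, h]
    exact LinearMap.ker_zero

instance (J : Type) [Category* J] [Finite J] : S.inOProp.IsClosedUnderLimitsOfShape J where
  limitsOfShape_le := by
    rintro X ⟨p⟩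
    refine InO.of_injective (S.inO_pi p.prop_diag_obj)
      (f := LinearMap.pi fun j => (p.π.app j).hom) fun x y hxy => ?_
    have h : ModuleCat.ofHom (LinearMap.toSpanSingleton (UEA K g) X x) =
        ModuleCat.ofHom (LinearMap.toSpanSingleton (UEA K g) X y) :=
      p.isLimit.hom_ext fun j => by
        ext
        simpa using congrFun hxy j
    simpa using congrArg (fun φ => φ.hom (1 : UEA K g)) h

instance : S.inOProp.IsClosedUnderFiniteProducts where
  isClosedUnderLimitsOfShape J _ :=
    have : Finite (Discrete J) := Finite.of_equiv J discreteEquiv.symm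
    inferInstance

instance : S.inOProp.ContainsZero where
  exists_zero := ⟨ModuleCat.of _ PUnit, ModuleCat.isZero_of_subsingleton _,
    S.inO_of_iSup_range_eq_top (J := Empty) (X := fun _ => PUnit) nofun nofun
      (Subsingleton.elim (α := Submodule _ _) _ _)⟩

instance : HasColimitsOfSize.{0, 0} (catO S) where
  has_colimits_of_shape _ _ := hasColimitsOfShape_of_closedUnderColimits _ S.inOProp

instance : HasFiniteLimits (catO S) where
  out _ _ _ := hasLimitsOfShape_of_closedUnderLimits _ S.inOProp

instance : PreservesFiniteLimits S.inOProp.ι where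
  preservesFiniteLimits _ _ _ := inferInstance

instance : AB5 (catO S) where
  ofShape J _ _ := HasExactColimitsOfShape.domain_of_functor J S.inOProp.ι

/-- The cyclic modules in category `O`. -/
def cyclicO (I : {I : Submodule (UEA K g) (UEA K g) // S.InO (UEA K g ⧸ I)}) : catO S :=
  ⟨ModuleCat.of (UEA K g) (UEA K g ⧸ I.1), I.2⟩

/-- Every object of category `O` is a sum of images of cyclic modules in category `O`. -/
lemma isSeparating_cyclicO : ObjectProperty.IsSeparating (.ofObj S.cyclicO) := by
  intro X Y u v huv
  ext x
  let φ := LinearMap.toSpanSingleton (UEA K g) X.obj x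
  have hinj : Function.Injective ((LinearMap.ker φ).liftQ φ le_rfl) :=
    LinearMap.ker_eq_bot.1 (Submodule.ker_liftQ_eq_bot _ _ _ le_rfl)
  have h := huv (S.cyclicO ⟨LinearMap.ker φ, InO.of_injective X.property hinj⟩) ⟨_⟩
    (ObjectProperty.homMk (ModuleCat.ofHom ((LinearMap.ker φ).liftQ φ le_rfl)))
  have h₁ : u.hom.hom (φ 1) = v.hom.hom (φ 1) :=
    congrArg (fun w => w.hom.hom (Submodule.Quotient.mk (1 : UEA K g))) h
  rwa [LinearMap.toSpanSingleton_apply, one_smul] at h₁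

end RootReductive

/-- `O` is a Grothendieck category: it is abelian, admits set-indexed
direct sums, filtered colimits are exact (AB5), and it has a generator.  In particular
it has enough injective objects. -/
theorem category_O_is_grothendieck (S : RootReductive K g) (hD : S.IsDynkin) :
    Nonempty (Abelian (catO S)) ∧
    HasCoproducts.{0} (catO S) ∧
    (∃ _ : HasFilteredColimits (catO S), AB5 (catO S)) ∧
    (∃ G : catO S, IsSeparator G) ∧
    EnoughInjectives (catO S) := by
  have : HasSeparator (catO S) := ⟨_, (isSeparator_sigma _).2 S.isSeparating_cyclicO⟩
  have : IsGrothendieckAbelian.{0} (catO S) := {}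
  exact ⟨⟨inferInstance⟩, inferInstance, ⟨inferInstance, inferInstance⟩,
    HasSeparator.hasSeparator, inferInstance⟩
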